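/- If μ is a positive finite Borel measure on ℝ whose Stieltjes transform satisfies s_μ(z) = (−z + √(z²−4))/2 for all z ∈ ℂ₊ (with the branch of √(z²−4) continuous on ℂ₊ ∪ ℝ having nonnegative imaginary part), then μ is the semicircle distribution, i.e. μ(dx) = (1/(2π))·√((4−x²)₊) dx. -/

import Mathlib

open MeasureTheory Real

/-- The Stieltjes transform of a measure on `ℝ`. -/
noncomputable def stieltjes (μ : Measure ℝ) (z : ℂ) : ℂ :=
  ∫ x, ((x : ℂ) - z)⁻¹ ∂μ

/-- The branch `√(z² − 4) := √(z−2)·√(z+2)` (principal square roots), which is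
continuous on the closed upper half-plane and has nonnegative imaginary part there. -/
noncomputable def sqrtZSqSubFour (z : ℂ) : ℂ :=
  (z - 2) ^ ((1 : ℂ) / 2) * (z + 2) ^ ((1 : ℂ) / 2)

open Filter Topology

lemma aux_K_bound {y : ℝ} (hy : 0 < y) (s : ℝ) : ‖y / (s ^ 2 + y ^ 2)‖ ≤ 1 / y := by
  rw [Real.norm_of_nonneg (by positivity), div_le_div_iff₀ (by positivity) hy]
  nlinarith [sq_nonneg s]

lemma aux_im (μ : Measure ℝ) [IsFiniteMeasure μ] (x : ℝ) {y : ℝ} (hy : 0 < y) :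
    (stieltjes μ ((x : ℂ) + y * Complex.I)).im = ∫ t, y / ((t - x) ^ 2 + y ^ 2) ∂μ := by
  have hne : ∀ t : ℝ, (t : ℂ) - ((x : ℂ) + y * Complex.I) ≠ 0 := by
    intro t h0
    have := congrArg Complex.im h0
    simp at this
    exact hy.ne' this
  have hint : Integrable (fun t : ℝ => ((t : ℂ) - ((x : ℂ) + y * Complex.I))⁻¹) μ := by
    refine Integrable.of_bound (C := 1 / y) ?_ ?_
    · apply Continuous.aestronglyMeasurable
      exact Continuous.inv₀ (by fun_prop) hne
    · refine Eventually.of_forall fun t => ?_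
      rw [norm_inv, one_div]
      apply inv_anti₀ hy
      have := Complex.abs_im_le_norm ((t : ℂ) - ((x : ℂ) + y * Complex.I))
      simp only [Complex.sub_im, Complex.ofReal_im, Complex.add_im, Complex.mul_im,
        Complex.ofReal_re, Complex.I_im, Complex.I_re] at this
      refine le_trans (le_of_eq ?_) this
      rw [show (0 : ℝ) - (0 + (y * 1 + 0 * 0)) = -y by ring, abs_neg, abs_of_pos hy]
  unfold stieltjes
  have := Complex.imCLM.integral_comp_comm hint
  simp only [Complex.imCLM_apply] at this
  rw [← this]
  congr 1
  ext t
  rw [Complex.inv_im]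
  simp [Complex.normSq_apply]
  congr 1
  ring

lemma aux_fubini (μ : Measure ℝ) [IsFiniteMeasure μ] (f : ℝ → ℝ) (hf : Integrable f)
    {y : ℝ} (hy : 0 < y) :
    ∫ x, f x * ∫ t, y / ((t - x) ^ 2 + y ^ 2) ∂μ
      = ∫ t, (∫ x, f x * (y / ((t - x) ^ 2 + y ^ 2))) ∂μ := by
  simp_rw [← integral_const_mul]
  apply integral_integral_swap
  have h1 : Integrable (fun p : ℝ × ℝ => f p.1 * (1 : ℝ)) (volume.prod μ) :=
    hf.mul_prod (integrable_const (1 : ℝ))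
  simp only [mul_one] at h1
  refine h1.mul_bdd (c := 1 / y) ?_ ?_
  · apply Continuous.aestronglyMeasurable
    refine Continuous.div (by fun_prop) (by fun_prop) fun p => by positivity
  · exact Eventually.of_forall fun p => aux_K_bound hy _

lemma aux_subst (f : ℝ → ℝ) (t : ℝ) {y : ℝ} (hy : 0 < y) :
    ∫ x, f x * (y / ((t - x) ^ 2 + y ^ 2)) = ∫ u, f (t + y * u) * (1 + u ^ 2)⁻¹ := by
  have h1 := Measure.integral_comp_mul_left
    (fun x => f (t + x) * (y ^ 2 / (x ^ 2 + y ^ 2))) y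
  have h2 : ∀ u : ℝ, f (t + y * u) * (y ^ 2 / ((y * u) ^ 2 + y ^ 2))
      = f (t + y * u) * (1 + u ^ 2)⁻¹ := by
    intro u
    congr 1
    have : 1 + u ^ 2 ≠ 0 := by positivity
    field_simp
    ring
  simp only [h2] at h1
  rw [h1, ← integral_add_left_eq_self (μ := volume) _ t, smul_eq_mul, ← integral_const_mul]
  congr 1
  ext x
  rw [abs_of_pos (by positivity)]
  have : x ^ 2 + y ^ 2 ≠ 0 := by positivity
  rw [show (t - (t + x)) ^ 2 = x ^ 2 by ring]
  field_simp

lemma aux_lim_left (μ : Measure ℝ) [IsFiniteMeasure μ] (f : ℝ → ℝ) (hf : Continuous f)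
    (C : ℝ) (hC : ∀ x, ‖f x‖ ≤ C) :
    Tendsto (fun y : ℝ => ∫ t, (∫ u, f (t + y * u) * (1 + u ^ 2)⁻¹) ∂μ) (𝓝[>] 0)
      (𝓝 (∫ t, f t * π ∂μ)) := by
  have hb : ∀ y t u : ℝ, ‖f (t + y * u) * (1 + u ^ 2)⁻¹‖ ≤ C * (1 + u ^ 2)⁻¹ := by
    intro y t u
    rw [norm_mul, Real.norm_of_nonneg (r := (1 + u ^ 2)⁻¹) (by positivity)]
    exact mul_le_mul_of_nonneg_right (hC _) (by positivity)
  have hint : Integrable (fun u : ℝ => C * (1 + u ^ 2)⁻¹) :=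
    integrable_inv_one_add_sq.const_mul C
  have hcont : Continuous fun u : ℝ => (1 + u ^ 2)⁻¹ :=
    Continuous.inv₀ (by fun_prop) fun u => by positivity
  refine tendsto_integral_filter_of_dominated_convergence (fun _ => C * π) ?_ ?_
    (integrable_const _) ?_
  · refine Eventually.of_forall fun y => ?_
    have : StronglyMeasurable (Function.uncurry fun t u : ℝ => f (t + y * u) * (1 + u ^ 2)⁻¹) := by
      apply Continuous.stronglyMeasurable
      exact (hf.comp (by fun_prop)).mul (hcont.comp continuous_snd)
    exact this.integral_prod_right.aestronglyMeasurable
  · refine Eventually.of_forall fun y => Eventually.of_forall fun t => ?_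
    refine (norm_integral_le_of_norm_le hint (Eventually.of_forall (hb y t))).trans (le_of_eq ?_)
    rw [integral_const_mul, integral_univ_inv_one_add_sq]
  · refine Eventually.of_forall fun t => ?_
    rw [← integral_univ_inv_one_add_sq, ← integral_const_mul]
    refine tendsto_integral_filter_of_dominated_convergence (fun u => C * (1 + u ^ 2)⁻¹) ?_ ?_
      hint ?_
    · refine Eventually.of_forall fun y => ?_
      exact ((hf.comp (by fun_prop)).mul hcont).aestronglyMeasurable
    · exact Eventually.of_forall fun y => Eventually.of_forall fun u => hb y t u
    · refine Eventually.of_forall fun u => ?_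
      refine Tendsto.mul_const _ ?_
      have : Continuous fun y : ℝ => f (t + y * u) := hf.comp (by fun_prop)
      have h2 := this.tendsto 0
      simp only [zero_mul, add_zero] at h2
      exact h2.mono_left nhdsWithin_le_nhds

lemma aux_cpow_lim {a : ℝ} (ha : a ≠ 0) :
    Tendsto (fun y : ℝ => ((a : ℂ) + y * Complex.I) ^ ((1 : ℂ) / 2)) (𝓝[>] 0)
      (𝓝 ((a : ℂ) ^ ((1 : ℂ) / 2))) := by
  have hbase : Tendsto (fun y : ℝ => (a : ℂ) + y * Complex.I) (𝓝[>] 0) (𝓝 (a : ℂ)) := by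
    have : Continuous fun y : ℝ => (a : ℂ) + y * Complex.I := by fun_prop
    have h2 := this.tendsto 0
    simp only [Complex.ofReal_zero, zero_mul, add_zero] at h2
    exact h2.mono_left nhdsWithin_le_nhds
  have hlog : Tendsto (fun y : ℝ => Complex.log ((a : ℂ) + y * Complex.I)) (𝓝[>] 0)
      (𝓝 (Complex.log a)) := by
    rcases lt_or_gt_of_ne ha with h | h
    · have h1 := Complex.continuousWithinAt_log_of_re_neg_of_im_zero (z := (a : ℂ))
        (by simpa using h) (by simp)
      refine h1.tendsto.comp (tendsto_nhdsWithin_iff.2 ⟨hbase, ?_⟩)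
      filter_upwards [self_mem_nhdsWithin] with y hy
      simpa using (le_of_lt hy)
    · have h1 : ContinuousAt Complex.log (a : ℂ) :=
        continuousAt_clog (by simp [Complex.mem_slitPlane_iff, h])
      exact h1.tendsto.comp hbase
  have hne : ∀ y : ℝ, (a : ℂ) + y * Complex.I ≠ 0 := by
    intro y h0
    have := congrArg Complex.re h0
    simp at this
    exact ha this
  simp_rw [Complex.cpow_def_of_ne_zero (hne _)]
  rw [Complex.cpow_def_of_ne_zero (by exact_mod_cast ha)]
  exact (Complex.continuous_exp.tendsto _).comp (hlog.mul_const _)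

lemma aux_cpow_pos {a : ℝ} (ha : 0 ≤ a) : (a : ℂ) ^ ((1 : ℂ) / 2) = (Real.sqrt a : ℂ) := by
  rw [Real.sqrt_eq_rpow, Complex.ofReal_cpow ha]
  simp

lemma aux_cpow_neg {a : ℝ} (ha : a < 0) :
    (a : ℂ) ^ ((1 : ℂ) / 2) = Complex.I * (Real.sqrt (-a) : ℂ) := by
  rw [Complex.ofReal_cpow_of_nonpos ha.le, ← Complex.ofReal_neg, aux_cpow_pos (by linarith),
    mul_comm]
  congr 1
  rw [show (π : ℂ) * Complex.I * (1 / 2) = π / 2 * Complex.I by ring, Complex.exp_pi_div_two_mul_I]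

lemma aux_lim_im {x : ℝ} (h1 : x ≠ 2) (h2 : x ≠ -2) :
    Tendsto (fun y : ℝ => (sqrtZSqSubFour ((x : ℂ) + y * Complex.I)).im) (𝓝[>] 0)
      (𝓝 (Real.sqrt (max (4 - x ^ 2) 0))) := by
  have e1 := aux_cpow_lim (a := x - 2) (sub_ne_zero.2 h1)
  have e2 := aux_cpow_lim (a := x + 2) (fun h => h2 (by linarith))
  have e3 := (Complex.continuous_im.tendsto _).comp (e1.mul e2)
  have val : (((x - 2 : ℝ) : ℂ) ^ ((1 : ℂ) / 2) * ((x + 2 : ℝ) : ℂ) ^ ((1 : ℂ) / 2)).im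
      = Real.sqrt (max (4 - x ^ 2) 0) := by
    rcases lt_or_gt_of_ne h1 with h | h
    · rcases lt_or_gt_of_ne h2 with h' | h'
      · rw [aux_cpow_neg (by linarith), aux_cpow_neg (by linarith), max_eq_right (by nlinarith)]
        simp
      · rw [aux_cpow_neg (by linarith), aux_cpow_pos (by linarith), max_eq_left (by nlinarith),
          show 4 - x ^ 2 = -(x - 2) * (x + 2) by ring, Real.sqrt_mul (by linarith)]
        simp
    · rw [aux_cpow_pos (by linarith), aux_cpow_pos (by linarith), max_eq_right (by nlinarith)]
      simp
  rw [val] at e3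
  refine e3.congr fun y => ?_
  simp only [Function.comp, sqrtZSqSubFour]
  push_cast
  congr 3 <;> ring

lemma aux_norm_half (a : ℂ) : ‖a ^ ((1 : ℂ) / 2)‖ ≤ 1 + ‖a‖ := by
  have h := Complex.cpow_nat_inv_pow a (n := 2) two_ne_zero
  have h2 := congrArg norm h
  rw [norm_pow] at h2
  rw [one_div]
  push_cast at h2
  nlinarith [norm_nonneg (a ^ ((2 : ℂ)⁻¹)), norm_nonneg a]

lemma aux_im_bound (x y : ℝ) (hy : 0 < y) (hy1 : y < 1) :
    ‖(sqrtZSqSubFour ((x : ℂ) + y * Complex.I)).im‖ ≤ (4 + |x|) ^ 2 := by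
  have hn : ‖(x : ℂ) + y * Complex.I‖ ≤ |x| + 1 := by
    refine (norm_add_le _ _).trans ?_
    simp [abs_of_pos hy]
    exact hy1.le
  refine (Complex.abs_im_le_norm _).trans ?_
  unfold sqrtZSqSubFour
  rw [norm_mul, pow_two]
  gcongr
  · refine (aux_norm_half _).trans ?_
    have := norm_sub_le ((x : ℂ) + y * Complex.I) 2
    simp only [Complex.norm_ofNat] at this
    linarith
  · refine (aux_norm_half _).trans ?_
    have := norm_add_le ((x : ℂ) + y * Complex.I) 2
    simp only [Complex.norm_ofNat] at this
    linarith

lemma aux_lim_right (f : ℝ → ℝ) (hf : Continuous f) (hc : HasCompactSupport f) :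
    Tendsto (fun y : ℝ => ∫ x, f x *
        (1 / 2 * (sqrtZSqSubFour ((x : ℂ) + y * Complex.I)).im - y / 2)) (𝓝[>] 0)
      (𝓝 (∫ x, f x * (1 / 2 * Real.sqrt (max (4 - x ^ 2) 0)))) := by
  refine tendsto_integral_filter_of_dominated_convergence (fun x => ‖f x‖ * (4 + |x|) ^ 2)
    ?_ ?_ ?_ ?_
  · refine Eventually.of_forall fun y => Measurable.aestronglyMeasurable ?_
    unfold sqrtZSqSubFour
    have := hf.measurable
    fun_prop
  · have : Set.Ioo (0 : ℝ) 1 ∈ 𝓝[>] (0 : ℝ) := Ioo_mem_nhdsGT one_pos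
    filter_upwards [this] with y hy
    refine Eventually.of_forall fun x => ?_
    rw [norm_mul]
    refine mul_le_mul_of_nonneg_left ?_ (norm_nonneg _)
    have h1 := aux_im_bound x y hy.1 hy.2
    have h0 := abs_nonneg x
    obtain ⟨hy0, hy1⟩ := hy
    rw [Real.norm_eq_abs, abs_le] at h1 ⊢
    constructor <;> nlinarith
  · refine Continuous.integrable_of_hasCompactSupport (by fun_prop) ?_
    exact hc.norm.mul_right
  · have e1 : ∀ᵐ x : ℝ, x ≠ 2 := by simp [ae_iff]
    have e2 : ∀ᵐ x : ℝ, x ≠ -2 := by simp [ae_iff]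
    filter_upwards [e1, e2] with x h1 h2
    refine Tendsto.const_mul _ ?_
    have h3 : Tendsto (fun y : ℝ => y / 2) (𝓝[>] 0) (𝓝 0) := by
      have h4 : Continuous fun y : ℝ => y / 2 := by fun_prop
      have h5 := h4.tendsto 0
      simp only [zero_div] at h5
      exact h5.mono_left nhdsWithin_le_nhds
    have h6 := ((aux_lim_im h1 h2).const_mul (1 / 2)).sub h3
    rwa [sub_zero] at h6

theorem stieltjes_semicircle (μ : Measure ℝ) [IsFiniteMeasure μ]
    (h : ∀ z : ℂ, 0 < z.im → stieltjes μ z = (-z + sqrtZSqSubFour z) / 2) :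
    μ = volume.withDensity
      (fun x => ENNReal.ofReal ((2 * π)⁻¹ * Real.sqrt (max (4 - x ^ 2) 0))) := by
  have hgc : Continuous fun x : ℝ => (2 * π)⁻¹ * Real.sqrt (max (4 - x ^ 2) 0) := by fun_prop
  have hreg : IsLocallyFiniteMeasure (volume.withDensity
      (fun x : ℝ => ENNReal.ofReal ((2 * π)⁻¹ * Real.sqrt (max (4 - x ^ 2) 0)))) := by
    exact IsLocallyFiniteMeasure.withDensity_ofReal hgc
  apply Measure.ext_of_integral_eq_on_compactlySupported
  intro f
  have hf : Continuous f := f.continuous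
  have hc : HasCompactSupport f := f.hasCompactSupport
  obtain ⟨C, hC⟩ := hf.bounded_above_of_compact_support hc
  have L := aux_lim_left μ f hf C hC
  have R := aux_lim_right f hf hc
  have key : ∀ᶠ y : ℝ in 𝓝[>] 0, ∫ x, f x *
        (1 / 2 * (sqrtZSqSubFour ((x : ℂ) + y * Complex.I)).im - y / 2)
      = ∫ t, (∫ u, f (t + y * u) * (1 + u ^ 2)⁻¹) ∂μ := by
    filter_upwards [self_mem_nhdsWithin] with y hy
    have hy : 0 < y := hy
    simp_rw [← aux_subst f _ hy]
    rw [← aux_fubini μ f (hf.integrable_of_hasCompactSupport hc) hy]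
    congr 1
    ext x
    rw [← aux_im μ x hy, h _ (by simpa using hy)]
    have : ∀ w : ℂ, (w / 2).im = w.im / 2 := fun w => by simp
    rw [this]
    simp
    left
    ring
  have E := tendsto_nhds_unique (R.congr' key) L
  rw [integral_mul_const] at E
  have hpi := Real.pi_pos
  have E2 : ∫ t, f t ∂μ = π⁻¹ * ∫ x, f x * (1 / 2 * Real.sqrt (max (4 - x ^ 2) 0)) := by
    rw [E]
    field_simp
  rw [E2, integral_withDensity_eq_integral_toReal_smul (by fun_prop) (by simp),
    ← integral_const_mul]
  congr 1
  ext x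
  rw [ENNReal.toReal_ofReal (by positivity), smul_eq_mul]
  field_simp
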